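/- Under the stated hypotheses on F, for all s ∈ ℝ and x ∈ ℝ^N one has det( Id + D_xφ(s,x) ) = exp( ∫₀^s trace D_xF(r, φ(r,x) + x) dr ). In particular Id + D_xφ(s,x) is invertible and its determinant is strictly positive. -/

import Mathlib

open MeasureTheory Filter Topology

lemma det_differentiable_aux (N : ℕ) :
    Differentiable ℝ (fun M : Fin N → Fin N → ℝ => Matrix.det (Matrix.of M)) := by
  simp only [Matrix.det_apply, Matrix.of_apply]
  fun_prop

lemma det_deriv_aux (N : ℕ) (J A : ℝ → Matrix (Fin N) (Fin N) ℝ) (s : ℝ)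
    (h : ∀ i j, HasDerivAt (fun t => J t i j) ((A s * J s) i j) s) :
    HasDerivAt (fun t => (J t).det) ((A s).trace * (J s).det) s := by
  set D : (Fin N → Fin N → ℝ) → ℝ := fun M => Matrix.det (Matrix.of M) with hD
  have hd : HasFDerivAt D (fderiv ℝ D (fun i j => J s i j)) (fun i j => J s i j) :=
    (det_differentiable_aux N _).hasFDerivAt
  have hJ : HasDerivAt (fun t => (fun i j => J t i j : Fin N → Fin N → ℝ))
      (fun i j => (A s * J s) i j) s := by
    rw [hasDerivAt_pi]; intro i
    rw [hasDerivAt_pi]; intro j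
    exact h i j
  have h1 := hd.comp_hasDerivAt s hJ
  have hL : HasDerivAt (fun t : ℝ => (fun i j => J s i j + t * (A s * J s) i j : Fin N → Fin N → ℝ))
      (fun i j => (A s * J s) i j) 0 := by
    rw [hasDerivAt_pi]; intro i
    rw [hasDerivAt_pi]; intro j
    simpa using ((hasDerivAt_id (0:ℝ)).mul_const ((A s * J s) i j)).const_add (J s i j)
  have hd0 : HasFDerivAt D (fderiv ℝ D (fun i j => J s i j))
      (fun i j => J s i j + (0:ℝ) * (A s * J s) i j) := by simpa using hd
  have h2 := hd0.comp_hasDerivAt (0:ℝ) hL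
  have h3 : HasDerivAt (fun t : ℝ => (1 + (A s).trace * t +
      (Matrix.det (1 + (Polynomial.X : Polynomial ℝ) • (A s).map Polynomial.C)).divX.divX.eval t
        * t ^ 2) * (J s).det) ((A s).trace * (J s).det) 0 := by
    have hp := ((Matrix.det (1 + (Polynomial.X : Polynomial ℝ) •
      (A s).map Polynomial.C)).divX.divX.hasDerivAt (0:ℝ)).mul ((hasDerivAt_id (0:ℝ)).pow 2)
    have := ((((hasDerivAt_id (0:ℝ)).const_mul (A s).trace).const_add 1).add hp).mul_const (J s).det
    simpa using this
  have he : (D ∘ fun t : ℝ => (fun i j => J s i j + t * (A s * J s) i j : Fin N → Fin N → ℝ)) =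
      (fun t : ℝ => (1 + (A s).trace * t +
      (Matrix.det (1 + (Polynomial.X : Polynomial ℝ) • (A s).map Polynomial.C)).divX.divX.eval t
        * t ^ 2) * (J s).det) := by
    funext t
    rw [← Matrix.det_one_add_smul, ← Matrix.det_mul, add_mul, one_mul, smul_mul_assoc]
    rfl
  rw [he] at h2
  rw [← h2.unique h3]
  exact h1

lemma gronwall_fwd {E : Type*} [NormedAddCommGroup E] [NormedSpace ℝ E]
    (F : ℝ → E → E) (K : NNReal) (T : ℝ)
    (hL : ∀ t ∈ Set.Icc (-T) T, LipschitzWith K (F t)) (f g : ℝ → E)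
    (hf : ∀ t, HasDerivAt f (F t (f t)) t) (hg : ∀ t, HasDerivAt g (F t (g t)) t)
    (t : ℝ) (ht : t ∈ Set.Icc 0 T) : dist (f t) (g t) ≤ dist (f 0) (g 0) * Real.exp (K * T) := by
  have h := dist_le_of_trajectories_ODE_of_mem (v := F) (s := fun _ => Set.univ) (K := K)
    (f := f) (g := g) (a := 0) (b := T)
    (δ := dist (f 0) (g 0))
    (fun t ht => (hL t ⟨by linarith [ht.1, ht.2], ht.2.le⟩).lipschitzOnWith)
    (fun t _ => (hf t).continuousAt.continuousWithinAt)
    (fun t _ => (hf t).hasDerivWithinAt) (fun _ _ => trivial)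
    (fun t _ => (hg t).continuousAt.continuousWithinAt)
    (fun t _ => (hg t).hasDerivWithinAt) (fun _ _ => trivial) le_rfl t ht
  refine h.trans ?_
  have := ht.2
  gcongr
  linarith

lemma gronwall_two {E : Type*} [NormedAddCommGroup E] [NormedSpace ℝ E]
    (F : ℝ → E → E) (K : NNReal) (T : ℝ)
    (hL : ∀ t ∈ Set.Icc (-T) T, LipschitzWith K (F t)) (f g : ℝ → E)
    (hf : ∀ t, HasDerivAt f (F t (f t)) t) (hg : ∀ t, HasDerivAt g (F t (g t)) t)
    (t : ℝ) (ht : t ∈ Set.Icc (-T) T) :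
    dist (f t) (g t) ≤ dist (f 0) (g 0) * Real.exp (K * T) := by
  rcases le_total 0 t with h0 | h0
  · exact gronwall_fwd F K T hL f g hf hg t ⟨h0, ht.2⟩
  · have hr : ∀ f : ℝ → E, (∀ t, HasDerivAt f (F t (f t)) t) →
        ∀ t, HasDerivAt (fun u => f (-u)) (-(F (-t) (f (-t)))) t := by
      intro f hf t
      have := (hf (-t)).scomp t (hasDerivAt_neg t)
      simpa [Function.comp_def] using this
    have := gronwall_fwd (fun t x => -(F (-t) x)) K T
      (fun t ht => (hL (-t) ⟨by linarith [ht.2], by linarith [ht.1]⟩).neg)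
      (fun u => f (-u)) (fun u => g (-u)) (hr f hf) (hr g hg) (-t)
      ⟨by linarith, by linarith [ht.1]⟩
    simpa using this

/-- Variational equation. -/
lemma variational {E : Type*} [NormedAddCommGroup E] [NormedSpace ℝ E] [CompleteSpace E]
    (F ψ : ℝ → E → E)
    (hFc : Continuous (fun p : ℝ × E => F p.1 p.2))
    (hFd : ∀ s : ℝ, Differentiable ℝ (F s))
    (hDFc : Continuous (fun p : ℝ × E => fderiv ℝ (F p.1) p.2))
    (hbd : ∀ s₀ > (0:ℝ), ∃ M : ℝ, ∀ s ∈ Set.Icc (-s₀) s₀,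
      ∀ x : E, ‖F s x‖ ≤ M ∧ ‖fderiv ℝ (F s) x‖ ≤ M)
    (h0 : ∀ x, ψ 0 x = x)
    (h' : ∀ (s : ℝ) (x : E), HasDerivAt (fun t => ψ t x) (F s (ψ s x)) s)
    (hd : ∀ s : ℝ, Differentiable ℝ (ψ s)) (x v : E) (s : ℝ) :
    HasDerivAt (fun t => fderiv ℝ (ψ t) x v)
      (fderiv ℝ (F s) (ψ s x) (fderiv ℝ (ψ s) x v)) s := by
  have hψc : ∀ y, Continuous (fun t => ψ t y) := fun y =>
    continuous_iff_continuousAt.2 fun t => (h' t y).continuousAt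
  have hFψ : ∀ y, Continuous (fun t => F t (ψ t y)) := fun y =>
    hFc.comp (continuous_id.prodMk (hψc y))
  -- local uniform bounds
  have key : ∀ T > (0:ℝ), ∃ K : NNReal, (∀ t ∈ Set.Icc (-T) T, LipschitzWith K (F t)) := by
    intro T hT
    obtain ⟨M, hM⟩ := hbd T hT
    refine ⟨M.toNNReal, fun t ht => lipschitzWith_of_nnnorm_fderiv_le (𝕜 := ℝ) (hFd t) fun y => ?_⟩
    rw [← norm_toNNReal]
    exact Real.toNNReal_le_toNNReal (hM t ht y).2
  have bound : ∀ T > (0:ℝ), ∃ C : ℝ, ∀ t ∈ Set.Icc (-T) T, ∀ h : ℝ,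
      ‖h⁻¹ • (F t (ψ t (x + h • v)) - F t (ψ t x))‖ ≤ C := by
    intro T hT
    obtain ⟨K, hK⟩ := key T hT
    refine ⟨K * (‖v‖ * Real.exp (K * T)), fun t ht h => ?_⟩
    rcases eq_or_ne h 0 with rfl | hh
    · simp; positivity
    have h1 := gronwall_two F K T hK (fun t => ψ t (x + h • v)) (fun t => ψ t x)
      (fun t => h' t _) (fun t => h' t _) t ht
    have h2 := (hK t ht).dist_le_mul (ψ t (x + h • v)) (ψ t x)
    simp only [h0, dist_eq_norm, add_sub_cancel_left, norm_smul] at h1 h2 ⊢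
    rw [norm_inv]
    have hp : 0 < ‖h‖ := norm_pos_iff.2 hh
    rw [inv_mul_le_iff₀ hp]
    calc _ ≤ _ := h2
      _ ≤ K * (‖h‖ * ‖v‖ * Real.exp (K * T)) := by gcongr
      _ = _ := by ring
  have lim1 : ∀ t, Tendsto (fun h : ℝ => h⁻¹ • (ψ t (x + h • v) - ψ t x)) (𝓝[≠] 0)
      (𝓝 (fderiv ℝ (ψ t) x v)) := fun t =>
    ((hd t x).hasFDerivAt.hasLineDerivAt v).tendsto_slope_zero
  have lim2 : ∀ t, Tendsto (fun h : ℝ => h⁻¹ • (F t (ψ t (x + h • v)) - F t (ψ t x))) (𝓝[≠] 0)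
      (𝓝 (fderiv ℝ (F t) (ψ t x) (fderiv ℝ (ψ t) x v))) := fun t =>
    ((((hFd t (ψ t x)).hasFDerivAt).comp x (hd t x).hasFDerivAt).hasLineDerivAt
      v).tendsto_slope_zero
  have hinteg : ∀ a b (h : ℝ), h⁻¹ • (ψ b (x + h • v) - ψ b x) - h⁻¹ • (ψ a (x + h • v) - ψ a x) =
      ∫ t in a..b, h⁻¹ • (F t (ψ t (x + h • v)) - F t (ψ t x)) := by
    intro a b h
    rw [intervalIntegral.integral_eq_sub_of_hasDerivAt
      (f := fun t => h⁻¹ • (ψ t (x + h • v) - ψ t x))]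
    · intro t _
      exact ((h' t _).sub (h' t _)).const_smul h⁻¹
    · exact (((hFψ _).sub (hFψ _)).const_smul h⁻¹).intervalIntegrable _ _
  have hlip : ∀ T > (0:ℝ), ∃ C : ℝ, ∀ a ∈ Set.Icc (-T) T, ∀ b ∈ Set.Icc (-T) T,
      ‖fderiv ℝ (ψ b) x v - fderiv ℝ (ψ a) x v‖ ≤ C * |b - a| := by
    intro T hT
    obtain ⟨C, hC⟩ := bound T hT
    refine ⟨C, fun a ha b hb => ?_⟩
    refine le_of_tendsto ((lim1 b).sub (lim1 a)).norm (Eventually.of_forall fun h => ?_)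
    rw [hinteg]
    refine intervalIntegral.norm_integral_le_of_norm_le_const fun t ht => ?_
    exact hC t (Set.uIcc_subset_Icc ha hb (Set.uIoc_subset_uIcc ht)) h
  have hcont : Continuous (fun t => fderiv ℝ (ψ t) x v) := by
    rw [continuous_iff_continuousAt]
    intro a
    obtain ⟨C, hC⟩ := hlip (|a| + 1) (by positivity)
    have ha : a ∈ Set.Icc (-(|a|+1)) (|a|+1) :=
      ⟨by linarith [neg_abs_le a], by linarith [le_abs_self a]⟩
    rw [ContinuousAt, tendsto_iff_norm_sub_tendsto_zero]
    have hz : Tendsto (fun b => C * |b - a|) (𝓝 a) (𝓝 0) := by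
      have : Continuous (fun b => C * |b - a|) := by fun_prop
      simpa using this.tendsto a
    refine squeeze_zero' (Eventually.of_forall fun _ => norm_nonneg _) ?_ hz
    have hn : Set.Icc (-(|a|+1)) (|a|+1) ∈ 𝓝 a :=
      Icc_mem_nhds (by linarith [neg_abs_le a]) (by linarith [le_abs_self a])
    filter_upwards [hn] with b hb
    exact hC a ha b hb
  have hgc : Continuous (fun t => fderiv ℝ (F t) (ψ t x) (fderiv ℝ (ψ t) x v)) :=
    (hDFc.comp (continuous_id.prodMk (hψc x))).clm_apply hcont
  have hfin : ∀ b, fderiv ℝ (ψ b) x v - fderiv ℝ (ψ 0) x v =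
      ∫ t in (0:ℝ)..b, fderiv ℝ (F t) (ψ t x) (fderiv ℝ (ψ t) x v) := by
    intro b
    obtain ⟨C, hC⟩ := bound (|b| + 1) (by positivity)
    refine tendsto_nhds_unique ((lim1 b).sub (lim1 0)) ?_
    simp only [hinteg]
    refine intervalIntegral.tendsto_integral_filter_of_dominated_convergence (fun _ => C)
      ?_ ?_ (by simp) ?_
    · exact Eventually.of_forall fun h =>
        (((hFψ _).sub (hFψ _)).const_smul h⁻¹).aestronglyMeasurable
    · refine Eventually.of_forall fun h => Eventually.of_forall fun t ht => hC t ?_ h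
      refine Set.uIcc_subset_Icc ?_ ?_ (Set.uIoc_subset_uIcc ht)
      · exact ⟨by linarith [abs_nonneg b], by linarith [abs_nonneg b]⟩
      · exact ⟨by linarith [neg_abs_le b], by linarith [le_abs_self b]⟩
    · exact Eventually.of_forall fun t _ => lim2 t
  have heq : (fun t => fderiv ℝ (ψ t) x v) = fun b => (∫ t in (0:ℝ)..b,
      fderiv ℝ (F t) (ψ t x) (fderiv ℝ (ψ t) x v)) + fderiv ℝ (ψ 0) x v := by
    funext b
    rw [← hfin b]; abel
  have hder := (hgc.integral_hasStrictDerivAt 0 s).hasDerivAt.add_const (fderiv ℝ (ψ 0) x v)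
  rw [← heq] at hder
  exact hder





/-- Liouville's formula for the solution `φ(s,x)` of `∂_sφ(s,x) = F(s, φ(s,x) + x)`,
`φ(0,x) = 0`: the determinant of `Id + D_xφ(s,x)` equals the exponential of the time
integral of the trace of `D_xF` along the trajectory; in particular it is strictly
positive and `Id + D_xφ(s,x)` is invertible. -/
theorem stmt_6 (N : ℕ)
    (F : ℝ → EuclideanSpace ℝ (Fin N) → EuclideanSpace ℝ (Fin N))
    (φ : ℝ → EuclideanSpace ℝ (Fin N) → EuclideanSpace ℝ (Fin N))
    (hFc : Continuous (fun p : ℝ × EuclideanSpace ℝ (Fin N) => F p.1 p.2))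
    (hFd : ∀ s : ℝ, Differentiable ℝ (F s))
    (hDFc : Continuous (fun p : ℝ × EuclideanSpace ℝ (Fin N) => fderiv ℝ (F p.1) p.2))
    (hbd : ∀ s₀ > (0:ℝ), ∃ M : ℝ, ∀ s ∈ Set.Icc (-s₀) s₀,
      ∀ x : EuclideanSpace ℝ (Fin N), ‖F s x‖ ≤ M ∧ ‖fderiv ℝ (F s) x‖ ≤ M)
    (hφ0 : ∀ x, φ 0 x = 0)
    (hφ' : ∀ (s : ℝ) (x : EuclideanSpace ℝ (Fin N)),
      HasDerivAt (fun t => φ t x) (F s (φ s x + x)) s)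
    (hφd : ∀ s : ℝ, Differentiable ℝ (φ s)) :
    ∀ (s : ℝ) (x : EuclideanSpace ℝ (Fin N)),
      (ContinuousLinearMap.id ℝ (EuclideanSpace ℝ (Fin N)) + fderiv ℝ (φ s) x).det =
        Real.exp (∫ r in (0:ℝ)..s,
          LinearMap.trace ℝ (EuclideanSpace ℝ (Fin N))
            (fderiv ℝ (F r) (φ r x + x) :
              EuclideanSpace ℝ (Fin N) →ₗ[ℝ] EuclideanSpace ℝ (Fin N))) ∧
      0 < (ContinuousLinearMap.id ℝ (EuclideanSpace ℝ (Fin N)) + fderiv ℝ (φ s) x).det ∧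
      IsUnit (ContinuousLinearMap.id ℝ (EuclideanSpace ℝ (Fin N)) + fderiv ℝ (φ s) x) := by
  intro s x
  let ψ : ℝ → EuclideanSpace ℝ (Fin N) → EuclideanSpace ℝ (Fin N) := fun t y => φ t y + y
  have hd : ∀ t, Differentiable ℝ (ψ t) := fun t => (hφd t).add differentiable_id
  have h0 : ∀ y, ψ 0 y = y := fun y => by simp [ψ, hφ0]
  have h' : ∀ (t : ℝ) (y : EuclideanSpace ℝ (Fin N)), HasDerivAt (fun u => ψ u y) (F t (ψ t y)) t :=
    fun t y => (hφ' t y).add_const y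
  have hJ : ∀ t, ContinuousLinearMap.id ℝ (EuclideanSpace ℝ (Fin N)) + fderiv ℝ (φ t) x = fderiv ℝ (ψ t) x := by
    intro t
    rw [add_comm]
    exact ((hφd t x).hasFDerivAt.add (hasFDerivAt_id x)).fderiv.symm
  have hvar := variational F ψ hFc hFd hDFc hbd h0 h' hd x
  let b := (EuclideanSpace.basisFun (Fin N) ℝ).toBasis
  let J : ℝ → Matrix (Fin N) (Fin N) ℝ := fun t =>
    LinearMap.toMatrix b b (fderiv ℝ (ψ t) x : EuclideanSpace ℝ (Fin N) →ₗ[ℝ] EuclideanSpace ℝ (Fin N))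
  let A : ℝ → Matrix (Fin N) (Fin N) ℝ := fun t =>
    LinearMap.toMatrix b b (fderiv ℝ (F t) (ψ t x) : EuclideanSpace ℝ (Fin N) →ₗ[ℝ] EuclideanSpace ℝ (Fin N))
  have hdetJ : ∀ t, (fderiv ℝ (ψ t) x).det = (J t).det := fun t =>
    (LinearMap.det_toMatrix b _).symm
  have htrA : ∀ t, LinearMap.trace ℝ (EuclideanSpace ℝ (Fin N)) (fderiv ℝ (F t) (ψ t x) : EuclideanSpace ℝ (Fin N) →ₗ[ℝ] EuclideanSpace ℝ (Fin N)) = (A t).trace :=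
    fun t => LinearMap.trace_eq_matrix_trace ℝ b _
  have hdet : ∀ t, HasDerivAt (fun t => (J t).det) ((A t).trace * (J t).det) t := by
    intro t
    refine det_deriv_aux N J A t fun i j => ?_
    have h1 : A t * J t = LinearMap.toMatrix b b
        ((fderiv ℝ (F t) (ψ t x) : EuclideanSpace ℝ (Fin N) →ₗ[ℝ] EuclideanSpace ℝ (Fin N)) ∘ₗ (fderiv ℝ (ψ t) x : EuclideanSpace ℝ (Fin N) →ₗ[ℝ] EuclideanSpace ℝ (Fin N))) :=
      (LinearMap.toMatrix_comp b b b _ _).symm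
    rw [h1]
    have h2 := (EuclideanSpace.proj (𝕜 := ℝ) i : EuclideanSpace ℝ (Fin N) →L[ℝ] ℝ).hasFDerivAt.comp_hasDerivAt t
      (hvar (b j) t)
    simp only [J, LinearMap.toMatrix_apply]
    exact h2
  have hψc : Continuous (fun t => ψ t x) :=
    continuous_iff_continuousAt.2 fun t => (h' t x).continuousAt
  have hAc : Continuous (fun t => (A t).trace) := by
    have h1 : Continuous (fun t => fderiv ℝ (F t) (ψ t x)) :=
      hDFc.comp (continuous_id.prodMk hψc)
    have h2 : (fun t => (A t).trace) =
        fun t => ∑ i, EuclideanSpace.proj (𝕜 := ℝ) i (fderiv ℝ (F t) (ψ t x) (b i)) := by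
      funext t
      simp only [A, Matrix.trace, Matrix.diag, LinearMap.toMatrix_apply]
      rfl
    rw [h2]
    exact continuous_finsetSum _ fun i _ =>
      (EuclideanSpace.proj (𝕜 := ℝ) i : EuclideanSpace ℝ (Fin N) →L[ℝ] ℝ).continuous.comp (h1.clm_apply continuous_const)
  have hmain : (J s).det = Real.exp (∫ r in (0:ℝ)..s, (A r).trace) := by
    let G : ℝ → ℝ := fun t => (J t).det * Real.exp (-∫ r in (0:ℝ)..t, (A r).trace)
    have hG : ∀ t, HasDerivAt G 0 t := by
      intro t
      have h1 := (hdet t).mul ((hAc.integral_hasStrictDerivAt 0 t).hasDerivAt.neg.exp)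
      refine h1.congr_deriv ?_
      ring
    have hc := is_const_of_deriv_eq_zero (fun t => (hG t).differentiableAt)
      (fun t => (hG t).deriv) s 0
    have hJ0 : (J 0).det = 1 := by
      rw [← hdetJ]
      have : ψ 0 = id := funext h0
      rw [this, fderiv_id]
      simp [ContinuousLinearMap.det]
    simp only [G, hJ0, intervalIntegral.integral_same, neg_zero, Real.exp_zero, one_mul] at hc
    rw [Real.exp_neg] at hc
    exact (mul_inv_eq_one₀ (Real.exp_pos _).ne').1 hc
  have hres : (fderiv ℝ (ψ s) x).det = Real.exp (∫ r in (0:ℝ)..s,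
      LinearMap.trace ℝ (EuclideanSpace ℝ (Fin N)) (fderiv ℝ (F r) (ψ r x) : EuclideanSpace ℝ (Fin N) →ₗ[ℝ] EuclideanSpace ℝ (Fin N))) := by
    simp only [htrA]; rw [hdetJ, hmain]
  rw [hJ]
  have hpos : 0 < (fderiv ℝ (ψ s) x).det := by rw [hres]; exact Real.exp_pos _
  refine ⟨hres, hpos, ?_⟩
  exact ⟨(ContinuousLinearEquiv.unitsEquiv ℝ (EuclideanSpace ℝ (Fin N))).symm
    (ContinuousLinearMap.toContinuousLinearEquivOfDetNeZero _ hpos.ne'), by ext; rfl⟩
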